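/- Let R be an algebraic curvature tensor on ℝⁿ, let 2 ≤ p ≤ n−1, and let B < A be real numbers such that B < ⟨R^p(u¹ ∧ … ∧ u^p), u¹ ∧ … ∧ u^p⟩ < A for every orthonormal p-tuple (u¹,…,u^p) of vectors in ℝⁿ. Then for every (p−2)-element subset I of {1,…,n} and all distinct indices i, j, l not belonging to I, one has |⟨R^p(e_i ∧ e_j ∧ e^I), e_i ∧ e_l ∧ e^I⟩| ≤ (A−B)/2. -/

import Mathlib

open scoped BigOperators RealInnerProductSpace

noncomputable section

/-- An algebraic curvature tensor on a real module: a quadrilinear form with the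
symmetries of the Riemann curvature tensor. -/
structure AlgCurv (V : Type*) [AddCommGroup V] [Module ℝ V] where
  T : V →ₗ[ℝ] V →ₗ[ℝ] V →ₗ[ℝ] V →ₗ[ℝ] ℝ
  antisym₁ : ∀ x y z w, T x y z w = - T y x z w
  antisym₂ : ∀ x y z w, T x y z w = - T x y w z
  pairsym : ∀ x y z w, T x y z w = T z w x y
  bianchi : ∀ x y z w, T x y z w + T y z x w + T z x y w = 0

/-- Coordinates of the exterior algebra of ℝⁿ in the orthonormal basis `e^S`,
`S` ranging over subsets of `{1,…,n}`. -/
abbrev ExtCoord (n : ℕ) := Finset (Fin n) → ℝ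

/-- The sign `(-1)^{#{m ∈ S : m < i}}`. -/
def sgn {n : ℕ} (i : Fin n) (S : Finset (Fin n)) : ℝ :=
  (-1 : ℝ) ^ (S.filter fun m => m < i).card

/-- Exterior multiplication `(aⁱ)*` by `e_i`, in coordinates. -/
def wedgeE {n : ℕ} (i : Fin n) (f : ExtCoord n) : ExtCoord n :=
  fun S => if i ∈ S then sgn i S * f (S.erase i) else 0

/-- Interior multiplication `aⁱ` by `e_i`, in coordinates. -/
def contrE {n : ℕ} (i : Fin n) (f : ExtCoord n) : ExtCoord n :=
  fun S => if i ∈ S then 0 else sgn i S * f (insert i S)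

/-- Weitzenböck operator built from curvature components via Witten's formula
`R^p = Σ_{i,j,k,l} R_{ijkl} (aⁱ)* aʲ (aᵏ)* aˡ`. -/
def weitzOp {n : ℕ} (c : Fin n → Fin n → Fin n → Fin n → ℝ) (f : ExtCoord n) : ExtCoord n :=
  ∑ i, ∑ j, ∑ k, ∑ l, c i j k l • wedgeE i (contrE j (wedgeE k (contrE l f)))

/-- The standard orthonormal basis vector `e_i` of ℝⁿ. -/
def estd {n : ℕ} (i : Fin n) : EuclideanSpace ℝ (Fin n) := EuclideanSpace.single i 1

/-- The Weitzenböck curvature operator of an algebraic curvature tensor on ℝⁿ. -/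
def weitz {n : ℕ} (R : AlgCurv (EuclideanSpace ℝ (Fin n))) (f : ExtCoord n) : ExtCoord n :=
  weitzOp (fun i j k l => R.T (estd i) (estd j) (estd k) (estd l)) f

/-- The inner product on the exterior algebra making the `e^S` orthonormal. -/
def extInner {n : ℕ} (f g : ExtCoord n) : ℝ := ∑ S : Finset (Fin n), f S * g S

/-- The basis element `e^S` of the exterior algebra. -/
def eB {n : ℕ} (S : Finset (Fin n)) : ExtCoord n := fun T => if T = S then 1 else 0

/-- Sectional curvature `K(u,v) = -R(u,v,u,v)` (paper's sign convention). -/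
def sectK {V : Type*} [AddCommGroup V] [Module ℝ V] (R : AlgCurv V) (u v : V) : ℝ :=
  - R.T u v u v

/-- Wedging with a vector `x ∈ ℝⁿ`, in coordinates. -/
def wedgeV {n : ℕ} (x : EuclideanSpace ℝ (Fin n)) (f : ExtCoord n) : ExtCoord n :=
  ∑ i, x i • wedgeE i f

/-- The wedge product `u¹ ∧ … ∧ u^p` of a family of vectors. -/
def wedgeFam {n p : ℕ} (u : Fin p → EuclideanSpace ℝ (Fin n)) : ExtCoord n :=
  (List.ofFn u).foldr wedgeV (eB ∅)

/-- The sum of sectional curvatures `Σ_{i=1}^p Σ_{j=p+1}^n K(vⁱ,vʲ)`. -/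
def sumK {n : ℕ} (R : AlgCurv (EuclideanSpace ℝ (Fin n))) (p : ℕ)
    (v : Fin n → EuclideanSpace ℝ (Fin n)) : ℝ :=
  ∑ i ∈ Finset.univ.filter (fun i : Fin n => (i : ℕ) < p),
    ∑ j ∈ Finset.univ.filter (fun j : Fin n => p ≤ (j : ℕ)), sectK R (v i) (v j)

/-- The constant `D = (1/2)p(n−p) + (4/3)·binom(p,2)·binom(n−p,2)`. -/
def Dconst (n p : ℕ) : ℝ :=
  (1 : ℝ) / 2 * ((p * (n - p) : ℕ) : ℝ)
    + (4 : ℝ) / 3 * ((p.choose 2 * ((n - p).choose 2) : ℕ) : ℝ)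

/-- The pinching constant `C(n,p) = D/(1+D)`. -/
def Cnp (n p : ℕ) : ℝ := Dconst n p / (1 + Dconst n p)


theorem sgn_erase {n : ℕ} (i : Fin n) (S : Finset (Fin n)) : sgn i (S.erase i) = sgn i S := by
  unfold sgn
  congr 2
  ext m
  simp only [Finset.mem_filter, Finset.mem_erase]
  exact ⟨fun h => ⟨h.1.2, h.2⟩, fun h => ⟨⟨h.2.ne, h.1⟩, h.2⟩⟩

theorem extInner_comm {n : ℕ} (f g : ExtCoord n) : extInner f g = extInner g f := by
  simp only [extInner, mul_comm]

theorem extInner_add_right {n : ℕ} (f g h : ExtCoord n) :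
    extInner f (g + h) = extInner f g + extInner f h := by
  simp only [extInner, Pi.add_apply, mul_add, Finset.sum_add_distrib]

theorem extInner_smul_right {n : ℕ} (a : ℝ) (f g : ExtCoord n) :
    extInner f (a • g) = a * extInner f g := by
  simp only [extInner, Pi.smul_apply, smul_eq_mul, Finset.mul_sum, mul_left_comm]

theorem extInner_sum_right {n : ℕ} {ι : Type*} (s : Finset ι) (f : ExtCoord n)
    (g : ι → ExtCoord n) : extInner f (∑ k ∈ s, g k) = ∑ k ∈ s, extInner f (g k) := by
  simp only [extInner, Finset.sum_apply, Finset.mul_sum]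
  exact Finset.sum_comm

/-- Exterior and interior multiplication by `e_i` are adjoint. -/
theorem extInner_wedgeE_left {n : ℕ} (i : Fin n) (f g : ExtCoord n) :
    extInner (wedgeE i f) g = extInner f (contrE i g) := by
  simp only [extInner, wedgeE, contrE, ite_mul, zero_mul, mul_ite, mul_zero]
  have hcompl : ∀ F : Finset (Fin n) → ℝ,
      ∑ S, (if i ∈ S then 0 else F S) = ∑ S with i ∉ S, F S := fun F => by
    simp only [Finset.sum_filter, ite_not]
  rw [← Finset.sum_filter, hcompl]
  refine Finset.sum_nbij' (fun S => S.erase i) (fun S => insert i S) ?_ ?_ ?_ ?_ ?_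
  · simp
  · simp
  · intro S hS
    exact Finset.insert_erase (by simpa using hS)
  · intro S hS
    exact Finset.erase_insert (by simpa using hS)
  · intro S hS
    rw [Finset.insert_erase (by simpa using hS), sgn_erase]
    ring

theorem extInner_contrE_left {n : ℕ} (i : Fin n) (f g : ExtCoord n) :
    extInner (contrE i f) g = extInner f (wedgeE i g) := by
  rw [extInner_comm, ← extInner_wedgeE_left, extInner_comm]

theorem sum_reverse₄ {ι M : Type*} [Fintype ι] [AddCommMonoid M] (F : ι → ι → ι → ι → M) :
    ∑ a, ∑ b, ∑ c, ∑ d, F a b c d = ∑ d, ∑ c, ∑ b, ∑ a, F a b c d := by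
  have h₃ : ∀ G : ι → ι → ι → M, ∑ a, ∑ b, ∑ c, G a b c = ∑ c, ∑ b, ∑ a, G a b c := fun G =>
    Finset.sum_comm.trans <|
      (Finset.sum_congr rfl fun _ _ => Finset.sum_comm).trans Finset.sum_comm
  refine (Finset.sum_congr rfl fun a _ => h₃ (F a)).trans (Finset.sum_comm.trans ?_)
  refine Finset.sum_congr rfl fun d _ => Finset.sum_comm.trans ?_
  exact Finset.sum_congr rfl fun c _ => Finset.sum_comm

/-- The Weitzenböck curvature operator is self-adjoint. -/
theorem extInner_weitz_left {n : ℕ} (R : AlgCurv (EuclideanSpace ℝ (Fin n)))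
    (f g : ExtCoord n) : extInner (weitz R f) g = extInner f (weitz R g) := by
  have hR : ∀ x y z w, R.T x y z w = R.T w z y x := fun x y z w => by
    rw [R.pairsym, R.antisym₁, R.antisym₂, neg_neg]
  rw [extInner_comm]
  simp only [weitz, weitzOp, extInner_sum_right, extInner_smul_right]
  have key : ∀ a b c d : Fin n, extInner g (wedgeE a (contrE b (wedgeE c (contrE d f)))) =
      extInner f (wedgeE d (contrE c (wedgeE b (contrE a g)))) := fun a b c d => by
    rw [← extInner_contrE_left, ← extInner_wedgeE_left, ← extInner_contrE_left,
      ← extInner_wedgeE_left, extInner_comm]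
  simp only [key]
  rw [sum_reverse₄]
  refine Finset.sum_congr rfl fun d _ => Finset.sum_congr rfl fun c _ =>
    Finset.sum_congr rfl fun b _ => Finset.sum_congr rfl fun a _ => ?_
  rw [hR]

/-- The quadratic form of the Weitzenböck operator on a linear combination. -/
theorem extInner_weitz_add_smul {n : ℕ} (R : AlgCurv (EuclideanSpace ℝ (Fin n))) (a b : ℝ)
    (X Y : ExtCoord n) :
    extInner (weitz R (a • X + b • Y)) (a • X + b • Y) =
      a ^ 2 * extInner (weitz R X) X + 2 * (a * b) * extInner (weitz R X) Y +
        b ^ 2 * extInner (weitz R Y) Y := by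
  have expand : ∀ Z, extInner (weitz R (a • X + b • Y)) Z =
      a * extInner (weitz R X) Z + b * extInner (weitz R Y) Z := fun Z => by
    rw [extInner_weitz_left, extInner_comm, extInner_add_right, extInner_smul_right,
      extInner_smul_right, extInner_weitz_left, extInner_weitz_left, extInner_comm Z,
      extInner_comm Z, extInner_weitz_left, extInner_weitz_left]
  have hYX : extInner (weitz R Y) X = extInner (weitz R X) Y := by
    rw [extInner_weitz_left, extInner_comm]
  rw [expand, extInner_add_right, extInner_add_right]
  simp only [extInner_smul_right, hYX]
  ring

theorem wedgeE_add_smul {n : ℕ} (i : Fin n) (a b : ℝ) (f g : ExtCoord n) :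
    wedgeE i (a • f + b • g) = a • wedgeE i f + b • wedgeE i g := by
  ext S
  simp only [wedgeE, Pi.add_apply, Pi.smul_apply, smul_eq_mul]
  split_ifs <;> ring

theorem wedgeV_add_smul {n : ℕ} (a b : ℝ) (x y : EuclideanSpace ℝ (Fin n)) (f : ExtCoord n) :
    wedgeV (a • x + b • y) f = a • wedgeV x f + b • wedgeV y f := by
  simp only [wedgeV, PiLp.add_apply, PiLp.smul_apply, smul_eq_mul, add_smul,
    Finset.sum_add_distrib, Finset.smul_sum, mul_smul]

theorem wedgeV_estd {n : ℕ} (i : Fin n) (f : ExtCoord n) : wedgeV (estd i) f = wedgeE i f := by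
  simp [wedgeV, estd]

theorem wedgeE_eB_of_lt {n : ℕ} (i : Fin n) (S : Finset (Fin n)) (h : ∀ m ∈ S, i < m) :
    wedgeE i (eB S) = eB (insert i S) := by
  have hi : i ∉ S := fun hi => (h i hi).false
  ext T
  by_cases hT : T = insert i S
  · subst hT
    have hs : (insert i S).filter (fun m => m < i) = ∅ := by
      ext m
      simp only [Finset.mem_filter, Finset.mem_insert, Finset.notMem_empty, iff_false, not_and,
        not_lt]
      rintro (rfl | hm)
      · exact le_rfl
      · exact (h m hm).le
    simp [wedgeE, eB, sgn, hs, Finset.erase_insert hi]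
  · have hne : i ∈ T → T.erase i ≠ S := fun hiT hS => hT (by rw [← hS, Finset.insert_erase hiT])
    by_cases hiT : i ∈ T
    · simp [wedgeE, eB, hT, hne hiT]
    · simp [wedgeE, eB, hT, hiT]

theorem foldr_wedgeV_eq_eB {n : ℕ} (L : List (Fin n)) (hL : L.Pairwise (· < ·)) :
    (L.map estd).foldr wedgeV (eB ∅) = eB L.toFinset := by
  induction L with
  | nil => rfl
  | cons a L ih =>
    rw [List.pairwise_cons] at hL
    rw [List.map_cons, List.foldr_cons, ih hL.2, wedgeV_estd,
      wedgeE_eB_of_lt _ _ (by simpa using hL.1), List.toFinset_cons]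

theorem wedgeFam_orderEmbOfFin {n : ℕ} (I : Finset (Fin n)) :
    wedgeFam (fun k => estd (I.orderEmbOfFin rfl k)) = eB I := by
  have hmap : List.ofFn (fun k => estd (I.orderEmbOfFin rfl k)) =
      (List.ofFn (I.orderEmbOfFin rfl)).map estd := by
    rw [List.map_ofFn]
    rfl
  have hset : (List.ofFn (I.orderEmbOfFin rfl)).toFinset = I := by
    ext m
    rw [List.mem_toFinset, List.mem_ofFn', Finset.range_orderEmbOfFin, Finset.mem_coe]
  rw [wedgeFam, hmap, foldr_wedgeV_eq_eB, hset]
  exact List.pairwise_ofFn.2 fun a b hab => (I.orderEmbOfFin rfl).strictMono hab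

theorem wedgeFam_vecCons {n p : ℕ} (x : EuclideanSpace ℝ (Fin n))
    (u : Fin p → EuclideanSpace ℝ (Fin n)) :
    wedgeFam (Matrix.vecCons x u) = wedgeV x (wedgeFam u) := by
  simp [wedgeFam, List.ofFn_succ]

theorem inner_estd {n : ℕ} (i j : Fin n) :
    inner ℝ (estd i) (estd j) = if i = j then (1 : ℝ) else 0 := by
  rw [estd, EuclideanSpace.inner_single_left]
  simp [estd]

/-- If `a ^ 2 + b ^ 2 = 1`, the vectors `e_i`, `a e_j + b e_l` and `e_m` for `m ∈ I` are
orthonormal. -/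
theorem orthonormal_vecCons_estd {n : ℕ} (I : Finset (Fin n)) {i j l : Fin n} (hij : i ≠ j)
    (hil : i ≠ l) (hjl : j ≠ l) (hiI : i ∉ I) (hjI : j ∉ I) (hlI : l ∉ I) {a b : ℝ}
    (hab : a ^ 2 + b ^ 2 = 1) :
    Orthonormal ℝ (Matrix.vecCons (estd i) (Matrix.vecCons (a • estd j + b • estd l)
      fun k => estd (I.orderEmbOfFin rfl k))) := by
  have hne : ∀ m, m ∉ I → ∀ k, m ≠ I.orderEmbOfFin rfl k := fun m hm k h =>
    hm (h ▸ I.orderEmbOfFin_mem rfl k)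
  have hbase : Orthonormal ℝ (fun k => (estd (I.orderEmbOfFin rfl k) :
      EuclideanSpace ℝ (Fin n))) := by
    rw [orthonormal_iff_ite]
    intro k k'
    simp [inner_estd]
  rw [orthonormal_vecCons_iff, orthonormal_vecCons_iff]
  refine ⟨by simp [estd], ?_, ?_, ?_, hbase⟩
  · refine Fin.cases ?_ fun k => ?_
    · simp [inner_add_right, inner_smul_right, inner_estd, hij, hil]
    · simp [inner_estd, hne i hiI k]
  · have hsq : ‖a • (estd j : EuclideanSpace ℝ (Fin n)) + b • estd l‖ ^ 2 = 1 := by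
      rw [← real_inner_self_eq_norm_sq]
      simp only [inner_add_left, inner_add_right, inner_smul_left, inner_smul_right, inner_estd,
        hjl, hjl.symm, if_true, if_false, conj_trivial]
      linarith
    exact (pow_eq_one_iff_of_nonneg (norm_nonneg _) two_ne_zero).1 hsq
  · intro k
    simp [inner_add_left, inner_smul_left, inner_estd, hne j hjI k, hne l hlI k]

/-- Lemma 3.1(iii). If `B < ⟨R^p(u¹∧…∧u^p), u¹∧…∧u^p⟩ < A` for every
orthonormal `p`-tuple, then `|⟨R^p(e_i∧e_j∧e^I), e_i∧e_l∧e^I⟩| ≤ (A−B)/2`. -/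
theorem statement4 (n p : ℕ) (hp2 : 2 ≤ p) (hpn : p + 1 ≤ n)
    (R : AlgCurv (EuclideanSpace ℝ (Fin n))) (A B : ℝ) (hBA : B < A)
    (hpinch : ∀ u : Fin p → EuclideanSpace ℝ (Fin n), Orthonormal ℝ u →
      B < extInner (weitz R (wedgeFam u)) (wedgeFam u) ∧
        extInner (weitz R (wedgeFam u)) (wedgeFam u) < A)
    (I : Finset (Fin n)) (hI : I.card + 2 = p)
    (i j l : Fin n) (hij : i ≠ j) (hil : i ≠ l) (hjl : j ≠ l)
    (hiI : i ∉ I) (hjI : j ∉ I) (hlI : l ∉ I) :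
    |extInner (weitz R (wedgeE i (wedgeE j (eB I)))) (wedgeE i (wedgeE l (eB I)))|
      ≤ (A - B) / 2 := by
  subst hI
  have bound : ∀ a b : ℝ, a ^ 2 + b ^ 2 = 1 →
      B < extInner (weitz R (a • wedgeE i (wedgeE j (eB I)) + b • wedgeE i (wedgeE l (eB I))))
          (a • wedgeE i (wedgeE j (eB I)) + b • wedgeE i (wedgeE l (eB I))) ∧
        extInner (weitz R (a • wedgeE i (wedgeE j (eB I)) + b • wedgeE i (wedgeE l (eB I))))
          (a • wedgeE i (wedgeE j (eB I)) + b • wedgeE i (wedgeE l (eB I))) < A := by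
    intro a b hab
    have h := hpinch _ (orthonormal_vecCons_estd I hij hil hjl hiI hjI hlI hab)
    rwa [wedgeFam_vecCons, wedgeFam_vecCons, wedgeFam_orderEmbOfFin, wedgeV_add_smul,
      wedgeV_estd, wedgeV_estd, wedgeV_estd, wedgeE_add_smul] at h
  have hs : (√2)⁻¹ ^ 2 = (1 / 2 : ℝ) := by
    rw [inv_pow, Real.sq_sqrt zero_le_two, one_div]
  have hplus := bound (√2)⁻¹ (√2)⁻¹ (by rw [hs]; norm_num)
  have hminus := bound (√2)⁻¹ (-(√2)⁻¹) (by rw [neg_sq, hs]; norm_num)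
  rw [extInner_weitz_add_smul] at hplus hminus
  rw [mul_neg, neg_sq, ← sq, hs] at hminus
  rw [← sq, hs] at hplus
  rw [abs_le]
  constructor <;> linarith [hplus.1, hplus.2, hminus.1, hminus.2]

end
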